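/- In a locally mintermised SFA, for any transition (q, φ, p) ∈ Δ, any state r, and any relation Sim ⊆ Q × Q, the cardinality of the set {p' | q →a p' and (r, p') ∈ Sim} is the same for all symbols a ∈ ⟦φ⟧. -/

import Mathlib

/-- A symbolic finite automaton: states `Q`, domain `D`, predicates `P`
with denotation `denote`, symbolic transitions `Δ`, initial and final states. -/
structure SFA (Q D P : Type) where
  denote : P → Set D
  Δ : Set (Q × P × Q)
  I : Set Q
  F : Set Q

/-- Concrete transition `q →a p`. -/
def SFA.Move {Q D P : Type} (M : SFA Q D P) (q : Q) (a : D) (p : Q) : Prop :=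
  ∃ ψ, (q, ψ, p) ∈ M.Δ ∧ a ∈ M.denote ψ

/-- `S` is a simulation on `M`. -/
def SFA.IsSimulation {Q D P : Type} (M : SFA Q D P) (S : Set (Q × Q)) : Prop :=
  ∀ p r, (p, r) ∈ S →
    (p ∈ M.F → r ∈ M.F) ∧
    ∀ a p', M.Move p a p' → ∃ r', M.Move r a r' ∧ (p', r') ∈ S

/-- In a locally mintermised SFA (for each state, the predicates on its outgoing
transitions are pairwise disjoint), for any transition `(q,φ,p) ∈ Δ`, state `r`,
and relation `Sim`, the cardinality of `{p' | q →a p' ∧ (r,p') ∈ Sim}` is the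
same for all `a ∈ ⟦φ⟧`. -/
theorem locally_mintermised_card_eq {Q D P : Type} (M : SFA Q D P)
    (hloc : ∀ p : Q, ∀ φ ψ : P, φ ∈ {φ : P | ∃ q, (p, φ, q) ∈ M.Δ} →
      ψ ∈ {φ : P | ∃ q, (p, φ, q) ∈ M.Δ} → φ ≠ ψ → M.denote φ ∩ M.denote ψ = ∅)
    (q p : Q) (φ : P) (hqp : (q, φ, p) ∈ M.Δ) (r : Q) (Sim : Set (Q × Q))
    (a b : D) (ha : a ∈ M.denote φ) (hb : b ∈ M.denote φ) :
    Set.ncard {p' : Q | M.Move q a p' ∧ (r, p') ∈ Sim} =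
    Set.ncard {p' : Q | M.Move q b p' ∧ (r, p') ∈ Sim} := by
  have key : ∀ c ∈ M.denote φ, ∀ p', M.Move q c p' ↔ (q, φ, p') ∈ M.Δ := by
    intro c hc p'
    constructor
    · rintro ⟨ψ, hψ, hcψ⟩
      by_cases h : φ = ψ
      · rw [h]; exact hψ
      · have h0 := hloc q φ ψ ⟨p, hqp⟩ ⟨p', hψ⟩ h
        have h1 : c ∈ M.denote φ ∩ M.denote ψ := ⟨hc, hcψ⟩
        rw [h0] at h1
        exact h1.elim
    · intro h
      exact ⟨φ, h, hc⟩
  simp only [key a ha, key b hb]
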